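/- arXiv:cs/0604093 — 2 statements merged into one kernel-verified Lean document; each statement's English description precedes it below -/
import Mathlib

section
/- Let K = Q(i, √p) with p ≡ 1 (mod 4) a prime, and let I be one of the two conjugate prime ideals appearing in the factorization (p)O_K = I²·Ī². Then the dual of I with respect to the trace form Tr_{K/Q(i)}(x·conj(y)) is I^# = (1/p)·I, and hence the complex lattice (1/√p)·Λ^c(I) is unimodular, i.e., equal to its own dual. -/
theorem exists_intCast_eq_of_isIntegral_ratCast {a : ℚ} (ha : IsIntegral ℤ (a : ℂ)) :
    ∃ m : ℤ, a = m := by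
  have h : IsIntegral ℤ (algebraMap ℚ ℂ a) := by simpa using ha
  rw [isIntegral_algebraMap_iff (algebraMap ℚ ℂ).injective] at h
  obtain ⟨m, hm⟩ := IsIntegrallyClosed.isIntegral_iff.mp h
  exact ⟨m, by simpa using hm.symm⟩

theorem isIntegral_complex_I : IsIntegral ℤ Complex.I :=
  IsIntegral.of_pow (n := 4) (by norm_num) (by rw [Complex.I_pow_four]; exact isIntegral_one)

theorem isIntegral_of_sq_eq_natCast {p : ℕ} {s : ℂ} (hs : s ^ 2 = p) : IsIntegral ℤ s :=
  IsIntegral.of_pow (n := 2) (by norm_num) (by rw [hs]; exact isIntegral_natCast p)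

theorem isIntegral_star {z : ℂ} (hz : IsIntegral ℤ z) : IsIntegral ℤ (star z) := by
  simpa using hz.map ((starRingEnd ℂ).toIntAlgHom)

/-- An algebraic integer of `ℚ(i)` is a Gaussian integer. -/
theorem exists_intCast_of_isIntegral_add_mul_I {a b : ℚ}
    (h : IsIntegral ℤ ((a : ℂ) + b * Complex.I)) : ∃ m n : ℤ, a = m ∧ b = n := by
  have hs := isIntegral_star h
  have hs' : star ((a : ℂ) + b * Complex.I) = a - b * Complex.I := by
    simp [sub_eq_add_neg]
  rw [hs'] at hs
  obtain ⟨A, hA⟩ : ∃ m : ℤ, 2 * a = m := exists_intCast_eq_of_isIntegral_ratCast <| by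
    refine (congrArg (IsIntegral ℤ) ?_).mpr (h.add hs)
    push_cast; ring
  obtain ⟨B, hB⟩ : ∃ m : ℤ, 2 * b = m := exists_intCast_eq_of_isIntegral_ratCast <| by
    refine (congrArg (IsIntegral ℤ) ?_).mpr ((hs.sub h).mul isIntegral_complex_I)
    push_cast
    linear_combination (2 * (b : ℂ)) * Complex.I_sq
  obtain ⟨N, hN⟩ : ∃ m : ℤ, a ^ 2 + b ^ 2 = m := exists_intCast_eq_of_isIntegral_ratCast <| by
    refine (congrArg (IsIntegral ℤ) ?_).mpr (h.mul hs)
    push_cast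
    linear_combination ((b : ℂ) ^ 2) * Complex.I_sq
  have hABN : A ^ 2 + B ^ 2 = 4 * N := by
    have : (A : ℚ) ^ 2 + B ^ 2 = 4 * N := by rw [← hA, ← hB, ← hN]; ring
    exact_mod_cast this
  obtain ⟨m, rfl | rfl⟩ := Int.even_or_odd' A <;> obtain ⟨n, rfl | rfl⟩ := Int.even_or_odd' B
  · refine ⟨m, n, ?_, ?_⟩
    · push_cast at hA; linarith
    · push_cast at hB; linarith
  all_goals ring_nf at hABN; lia

/-- If `p` is an odd prime and `√p (a + bi)` is an algebraic integer, then so is `a + bi`. -/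
theorem exists_intCast_of_isIntegral_mul_sqrt {p : ℕ} (hp : p.Prime) (hp2 : p ≠ 2) {s : ℂ}
    (hs : s ^ 2 = p) {a b : ℚ} (h : IsIntegral ℤ (s * ((a : ℂ) + b * Complex.I))) :
    ∃ m n : ℤ, a = m ∧ b = n := by
  have hsi : IsIntegral ℤ s := isIntegral_of_sq_eq_natCast hs
  obtain ⟨A, B, hA, hB⟩ : ∃ m n : ℤ, p * a = m ∧ p * b = n :=
    exists_intCast_of_isIntegral_add_mul_I <| by
      refine (congrArg (IsIntegral ℤ) ?_).mpr (hsi.mul h)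
      push_cast
      linear_combination (-((a : ℂ) + b * Complex.I)) * hs
  obtain ⟨M, N, hM, hN⟩ : ∃ m n : ℤ, p * (a ^ 2 - b ^ 2) = m ∧ p * (2 * a * b) = n :=
    exists_intCast_of_isIntegral_add_mul_I <| by
      refine (congrArg (IsIntegral ℤ) ?_).mpr (h.pow 2)
      push_cast
      linear_combination (-((a : ℂ) + b * Complex.I) ^ 2) * hs - p * (b : ℂ) ^ 2 * Complex.I_sq
  have h1 : A ^ 2 - B ^ 2 = p * M := by
    have : (A : ℚ) ^ 2 - B ^ 2 = p * M := by rw [← hA, ← hB, ← hM]; ring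
    exact_mod_cast this
  have h2 : 2 * (A * B) = p * N := by
    have : 2 * ((A : ℚ) * B) = p * N := by rw [← hA, ← hB, ← hN]; ring
    exact_mod_cast this
  have hpZ : Prime (p : ℤ) := Nat.prime_iff_prime_int.mp hp
  have h3 : (p : ℤ) ∣ A * B := (hpZ.dvd_or_dvd ⟨N, h2⟩).resolve_left fun hd => hp2 <|
    (Nat.prime_dvd_prime_iff_eq hp Nat.prime_two).mp (by exact_mod_cast hd)
  have h4 : (p : ℤ) ∣ A ∧ (p : ℤ) ∣ B := by
    rcases hpZ.dvd_or_dvd h3 with hd | hd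
    · refine ⟨hd, hpZ.dvd_of_dvd_pow (n := 2) ?_⟩
      have : B ^ 2 = A ^ 2 - p * M := by linarith
      rw [this]
      exact dvd_sub (dvd_pow hd two_ne_zero) (dvd_mul_right _ _)
    · refine ⟨hpZ.dvd_of_dvd_pow (n := 2) ?_, hd⟩
      have : A ^ 2 = B ^ 2 + p * M := by linarith
      rw [this]
      exact dvd_add (dvd_pow hd two_ne_zero) (dvd_mul_right _ _)
  obtain ⟨⟨m, rfl⟩, ⟨n, rfl⟩⟩ := h4
  have hp0 : (p : ℚ) ≠ 0 := by exact_mod_cast hp.ne_zero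
  push_cast at hA hB
  exact ⟨m, n, mul_left_cancel₀ hp0 hA, mul_left_cancel₀ hp0 hB⟩

open IntermediateField in
theorem exists_rat_coords_of_mem_adjoin_I_sqrt {p : ℕ} {s : ℂ} (hs : s ^ 2 = p) {x : ℂ}
    (hx : x ∈ ℚ⟮Complex.I, s⟯) :
    ∃ a b c d : ℚ, x = a + b * Complex.I + (c + d * Complex.I) * s := by
  have hsi : IsIntegral ℤ s := isIntegral_of_sq_eq_natCast hs
  rw [← mem_toSubalgebra, adjoin_toSubalgebra_of_isAlgebraic] at hx
  · induction hx using Algebra.adjoin_induction with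
    | mem x hx =>
      rcases hx with rfl | rfl
      · exact ⟨0, 1, 0, 0, by simp⟩
      · exact ⟨0, 0, 1, 0, by simp⟩
    | algebraMap r => exact ⟨r, 0, 0, 0, by simp⟩
    | add x y _ _ hx hy =>
      obtain ⟨a, b, c, d, rfl⟩ := hx
      obtain ⟨a', b', c', d', rfl⟩ := hy
      exact ⟨a + a', b + b', c + c', d + d', by push_cast; ring⟩
    | mul x y _ _ hx hy =>
      obtain ⟨a, b, c, d, rfl⟩ := hx
      obtain ⟨a', b', c', d', rfl⟩ := hy
      refine ⟨a * a' - b * b' + p * (c * c' - d * d'), a * b' + b * a' + p * (c * d' + d * c'),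
        a * c' - b * d' + c * a' - d * b', a * d' + b * c' + c * b' + d * a', ?_⟩
      push_cast
      linear_combination (((c : ℂ) + d * Complex.I) * (c' + d' * Complex.I)) * hs +
        ((b : ℂ) * b' + p * (d * d') + (b * d' + d * b') * s) * Complex.I_sq
  · rintro x (rfl | rfl)
    · exact (isIntegral_complex_I.tower_top (A := ℚ)).isAlgebraic
    · exact (hsi.tower_top (A := ℚ)).isAlgebraic


open IntermediateField NumberField in
theorem stmt_9 (p : ℕ) (hp : p.Prime) (h1 : p % 4 = 1)
    (K : IntermediateField ℚ ℂ)
    (hK : K = ℚ⟮Complex.I, ((Real.sqrt p : ℝ) : ℂ)⟯)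
    [NumberField K]
    (sp : K) (hsp : (sp : ℂ) = Real.sqrt p)
    (σ : K ≃ₐ[ℚ] K)
    (hσi : ∀ z : K, (z : ℂ) = Complex.I → ((σ z : K) : ℂ) = Complex.I)
    (hσs : ((σ sp : K) : ℂ) = -(Real.sqrt p : ℂ))
    (I : Ideal (𝓞 K)) (hIp : I.IsPrime) (hI0 : I ≠ ⊥)
    (c : 𝓞 K ≃+* 𝓞 K) (hc : ∀ x : 𝓞 K, ((c x : K) : ℂ) = star ((x : K) : ℂ))
    (hfact : Ideal.span {(p : 𝓞 K)} = (I * Ideal.map (c : 𝓞 K →+* 𝓞 K) I) ^ 2)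
    (hne : I ≠ Ideal.map (c : 𝓞 K →+* 𝓞 K) I) :
    -- the dual ideal I^# with respect to x ↦ Tr_{K/ℚ(i)}(x ⋅ conj y) equals (1/p)·I
    (∀ x : K,
      (∀ y : 𝓞 K, y ∈ I →
        ∃ m n : ℤ,
          (x : ℂ) * star ((y : K) : ℂ) + ((σ x : K) : ℂ) * star ((σ (y : K) : K) : ℂ)
            = (m : ℂ) + (n : ℂ) * Complex.I)
      ↔ ∃ z : 𝓞 K, z ∈ I ∧ (p : ℂ) * (x : ℂ) = ((z : K) : ℂ)) ∧
    -- hence the lattice (1/√p)·Λᶜ(I) is unimodular: it equals its own dual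
    (∀ x : K,
      (∀ y : 𝓞 K, y ∈ I →
        ∃ m n : ℤ,
          (x : ℂ) * star (((y : K) / sp : K) : ℂ)
            + ((σ x : K) : ℂ) * star ((σ ((y : K) / sp) : K) : ℂ)
            = (m : ℂ) + (n : ℂ) * Complex.I)
      ↔ ∃ z : 𝓞 K, z ∈ I ∧ (x : ℂ) * (Real.sqrt p : ℂ) = ((z : K) : ℂ)) := by
  set s : ℂ := ((Real.sqrt p : ℝ) : ℂ) with hs_def
  have hs : s ^ 2 = p := by
    rw [hs_def, ← Complex.ofReal_pow, Real.sq_sqrt (Nat.cast_nonneg p), Complex.ofReal_natCast]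
  have hstar : star s = s := Complex.conj_ofReal _
  have hp0 : (p : ℂ) ≠ 0 := by exact_mod_cast hp.ne_zero
  have hp2 : p ≠ 2 := by rintro rfl; norm_num at h1
  have two_coe : ((2 : K) : ℂ) = 2 := rfl
  have int_coe (m : ℤ) : (((m : 𝓞 K) : K) : ℂ) = m := by simp
  have integral_coe {x : K} : IsIntegral ℤ x ↔ IsIntegral ℤ (x : ℂ) :=
    (isIntegral_algebraMap_iff (algebraMap K ℂ).injective).symm
  have hsi : IsIntegral ℤ s := isIntegral_of_sq_eq_natCast hs
  have hIK : Complex.I ∈ K := by rw [hK]; exact subset_adjoin _ _ (by simp)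
  obtain ⟨i, hi⟩ : ∃ i : 𝓞 K, ((i : K) : ℂ) = Complex.I :=
    ⟨⟨⟨Complex.I, hIK⟩, integral_coe.mpr isIntegral_complex_I⟩, rfl⟩
  obtain ⟨S, hS⟩ : ∃ S : 𝓞 K, (S : K) = sp :=
    ⟨⟨sp, integral_coe.mpr (by rw [hsp]; exact hsi)⟩, rfl⟩
  obtain ⟨ω, hω⟩ : ∃ ω : 𝓞 K, (ω : K) = (1 + sp) / 2 := by
    refine ⟨⟨(1 + sp) / 2, integral_coe.mpr ?_⟩, rfl⟩
    push_cast
    rw [hsp, two_coe]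
    obtain ⟨k, hk⟩ : ∃ k : ℕ, p = 4 * k + 1 := ⟨p / 4, by omega⟩
    have hk' : (p : ℂ) = 4 * k + 1 := by exact_mod_cast hk
    refine ⟨Polynomial.X ^ 2 - Polynomial.X - Polynomial.C (k : ℤ), by monicity!, ?_⟩
    simp only [Polynomial.eval₂_sub, Polynomial.eval₂_pow, Polynomial.eval₂_X, Polynomial.eval₂_C]
    simp only [eq_intCast, Int.cast_natCast]
    linear_combination (1 / 4 : ℂ) * hs + (1 / 4 : ℂ) * hk'
  have hσS : ((σ (S : K) : K) : ℂ) = -s := by rw [hS]; exact hσs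
  have hSC : ((S : K) : ℂ) = s := by rw [hS]; exact hsp
  have hωC : ((ω : K) : ℂ) = (1 + s) / 2 := by rw [hω]; push_cast; rw [hsp, two_coe]
  have hσω : ((σ (ω : K) : K) : ℂ) = (1 - s) / 2 := by
    rw [hω, map_div₀, map_add, map_one, map_ofNat]; push_cast; rw [hσs, two_coe]; ring
  have coords (x : K) : ∃ a b c d : ℚ, (x : ℂ) = a + b * Complex.I + (c + d * Complex.I) * s :=
    exists_rat_coords_of_mem_adjoin_I_sqrt hs (hK ▸ x.2)
  have σ_coords (x : K) (a b c d : ℚ) (hx : (x : ℂ) = a + b * Complex.I + (c + d * Complex.I) * s) :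
      ((σ x : K) : ℂ) = a + b * Complex.I - (c + d * Complex.I) * s := by
    have : x = a + b * (i : K) + (c + d * (i : K)) * sp :=
      Subtype.ext (by push_cast; rw [hx, hi, hsp])
    rw [this]
    simp only [map_add, map_mul, map_ratCast]
    push_cast
    rw [hσi _ hi, hσs]
    ring
  have σ_conj (y : 𝓞 K) : ((σ (c y : K) : K) : ℂ) = star ((σ (y : K) : K) : ℂ) := by
    obtain ⟨a, b, d, e, h⟩ := coords y
    rw [σ_coords y a b d e h, σ_coords (c y) a (-b) d (-e)]
    · simp only [star_sub, star_add, star_mul', hstar]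
      simp
    · rw [hc, h]
      simp only [star_add, star_mul', hstar]
      simp
  have hprod : I * Ideal.map (c : 𝓞 K →+* 𝓞 K) I = Ideal.span {S} := by
    have hSp : (p : 𝓞 K) = S ^ 2 := by
      apply RingOfIntegers.coe_injective
      apply Subtype.ext
      push_cast
      rw [hSC, hs]
    rw [hSp, ← Ideal.span_singleton_pow] at hfact
    apply le_antisymm
    · rw [← Ideal.dvd_iff_le, ← UniqueFactorizationMonoid.pow_dvd_pow_iff_dvd two_ne_zero, hfact]
    · rw [← Ideal.dvd_iff_le, ← UniqueFactorizationMonoid.pow_dvd_pow_iff_dvd two_ne_zero, hfact]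
  have dual (x : K) :
      (∀ y : 𝓞 K, y ∈ I →
        ∃ m n : ℤ,
          (x : ℂ) * star ((y : K) : ℂ) + ((σ x : K) : ℂ) * star ((σ (y : K) : K) : ℂ)
            = (m : ℂ) + (n : ℂ) * Complex.I)
      ↔ ∃ z : 𝓞 K, z ∈ I ∧ (p : ℂ) * (x : ℂ) = ((z : K) : ℂ) := by
    constructor
    · intro h
      have key (y : 𝓞 K) (hy : y ∈ I) :
          ∃ r : 𝓞 K, ((r : K) : ℂ) = s * x * star ((y : K) : ℂ) := by
        obtain ⟨m, n, h₁⟩ := h y hy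
        obtain ⟨m', n', h₂⟩ := h (y * ω) (I.mul_mem_right _ hy)
        refine ⟨m' + n' * i - (m + n * i) * (1 - ω), ?_⟩
        push_cast at h₂ ⊢
        rw [map_mul] at h₂
        push_cast at h₂
        rw [hωC, hσω, star_mul', star_mul'] at h₂
        have e₁ : star ((1 + s) / 2) = (1 + s) / 2 := by simp [hstar]
        have e₂ : star ((1 - s) / 2) = (1 - s) / 2 := by simp [hstar]
        rw [e₁, e₂] at h₂
        rw [hi, hωC]
        simp only [int_coe]
        linear_combination ((1 - s) / 2) * h₁ - h₂
      have key' (t : 𝓞 K) (ht : t ∈ I * Ideal.map (c : 𝓞 K →+* 𝓞 K) I) :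
          ∃ z ∈ I, ((z : K) : ℂ) = ((t : K) : ℂ) * s * x := by
        induction ht using Submodule.mul_induction_on' with
        | mem_mul_mem a ha b hb =>
          obtain ⟨y, hy, rfl⟩ := (Ideal.mem_map_of_equiv c b).mp hb
          obtain ⟨r, hr⟩ := key y hy
          refine ⟨a * r, I.mul_mem_right _ ha, ?_⟩
          push_cast
          rw [hr, hc]
          ring
        | add a _ b _ ha hb =>
          obtain ⟨z, hz, ez⟩ := ha
          obtain ⟨w, hw, ew⟩ := hb
          refine ⟨z + w, I.add_mem hz hw, ?_⟩
          push_cast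
          rw [ez, ew]
          ring
      obtain ⟨z, hz, ez⟩ := key' S (hprod ▸ Ideal.mem_span_singleton_self S)
      refine ⟨z, hz, ?_⟩
      rw [ez, hSC, ← hs]
      ring
    · rintro ⟨z, hz, hxz⟩ y hy
      have hmem : z * c y ∈ Ideal.span {S} :=
        hprod ▸ Ideal.mul_mem_mul hz (Ideal.mem_map_of_mem (c : 𝓞 K →+* 𝓞 K) hy)
      obtain ⟨w, hw⟩ := Ideal.mem_span_singleton.mp hmem
      obtain ⟨a, b, d, e, hwc⟩ := coords w
      have hσw := σ_coords w a b d e hwc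
      have integral_int (v : 𝓞 K) : IsIntegral ℤ ((v : K) : ℂ) := integral_coe.mp v.2
      have integral_σ : IsIntegral ℤ ((σ (w : K) : K) : ℂ) :=
        integral_coe.mp (w.2.map (σ : K →ₐ[ℚ] K))
      obtain ⟨m, n, hm, hn⟩ : ∃ m n : ℤ, 2 * d = m ∧ 2 * e = n :=
        exists_intCast_of_isIntegral_mul_sqrt hp hp2 hs <| by
          refine (congrArg (IsIntegral ℤ) ?_).mpr ((integral_int w).sub integral_σ)
          rw [hwc, hσw]
          push_cast
          ring
      have hxz' : (p : ℂ) * ((σ x : K) : ℂ) = ((σ (z : K) : K) : ℂ) := by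
        have : (p : K) * x = z := Subtype.ext (by push_cast; exact hxz)
        rw [← this, map_mul, map_natCast]
        push_cast
        rfl
      have hwK : (z : K) * (c y : K) = S * w := by
        exact_mod_cast congrArg (fun v : 𝓞 K => (v : K)) hw
      have e₁ : ((z : K) : ℂ) * star ((y : K) : ℂ) = s * (w : K) := by
        rw [← hc, ← hSC]; exact_mod_cast hwK
      have e₂ : ((σ (z : K) : K) : ℂ) * star ((σ (y : K) : K) : ℂ) = -s * (σ (w : K) : K) := by
        rw [← σ_conj, ← hσS]
        exact_mod_cast (by rw [← map_mul, hwK, map_mul] :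
          σ (z : K) * σ (c y : K) = σ (S : K) * σ (w : K))
      have hm' : 2 * (d : ℂ) = m := by exact_mod_cast hm
      have hn' : 2 * (e : ℂ) = n := by exact_mod_cast hn
      refine ⟨m, n, mul_left_cancel₀ hp0 ?_⟩
      rw [← hxz] at e₁
      rw [← hxz'] at e₂
      rw [hwc] at e₁
      rw [hσw] at e₂
      rw [← hm', ← hn']
      linear_combination e₁ + e₂ + 2 * ((d : ℂ) + e * Complex.I) * hs
  refine ⟨dual, fun x => ?_⟩
  have hdiv := dual (x / sp)
  have hz (z : ℂ) : (p : ℂ) * ((x / sp : K) : ℂ) = z ↔ (x : ℂ) * s = z := by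
    have : (p : ℂ) * ((x / sp : K) : ℂ) = (x : ℂ) * s := by
      push_cast
      rw [hsp, ← hs]
      field_simp
    rw [this]
  simp only [hz] at hdiv
  rw [← hdiv]
  refine forall₂_congr fun y _ => ?_
  have : (x : ℂ) * star (((y : K) / sp : K) : ℂ)
      + ((σ x : K) : ℂ) * star ((σ ((y : K) / sp) : K) : ℂ)
      = ((x / sp : K) : ℂ) * star ((y : K) : ℂ)
        + ((σ (x / sp) : K) : ℂ) * star ((σ (y : K) : K) : ℂ) := by
    rw [map_div₀, map_div₀]
    push_cast
    rw [hsp, hσs, star_div₀, star_div₀, star_neg, hstar]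
    ring
  rw [this]
end

section
/- In K = Q(j, θ) with θ = ζ7 + ζ7^{-1} and j = e^{2πi/3}, the element α = (1+j) + θ generates a principal ideal of O_K of absolute norm 7, and the three elements ν₁ = (1+j)+θ, ν₂ = (-1-2j)+jθ², ν₃ = (-1-2j)+(1+j)θ+(1+j)θ² form a Z[j]-basis of (α)O_K satisfying Tr_{K/Q(j)}(ν_k·conj(ν_l)) = 7·δ_{kl} for k,l ∈ {1,2,3}. -/
/-- The data of a number field `K = ℚ(j, θ)`, where `j` is a primitive cube root of unity and `θ` is
a root of `X³ + X² - 2X - 1`, with the automorphism `σ` of order three fixing `j` and the complex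
conjugation `τ`. -/
structure EisensteinCubic (K : Type*) [Field K] [NumberField K] where
  j : K
  θ : K
  σ : K ≃ₐ[ℚ] K
  τ : K ≃ₐ[ℚ] K
  j_rel : j ^ 2 + j + 1 = 0
  θ_rel : θ ^ 3 + θ ^ 2 - 2 * θ - 1 = 0
  σ_j : σ j = j
  σ_θ : σ θ = θ ^ 2 - 2
  τ_j : τ j = -1 - j
  τ_θ : τ θ = θ
  exists_rep : ∀ x : K, ∃ a b c d e f : ℚ,
    x = (a + b * j) + (c + d * j) * θ + (e + f * j) * θ ^ 2

namespace EisensteinCubic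

variable {K : Type*} [Field K] [NumberField K] (D : EisensteinCubic K)

/-- The first element of the lattice basis, which generates the ideal. -/
def α : K := 1 + D.j + D.θ

/-- The three elements `ν₁, ν₂, ν₃` of the ideal generated by `α`. -/
def ν : Fin 3 → K :=
  ![1 + D.j + D.θ, (-1 - 2 * D.j) + D.j * D.θ ^ 2,
    (-1 - 2 * D.j) + (1 + D.j) * D.θ + (1 + D.j) * D.θ ^ 2]

/-- The relative trace to `ℚ(j)`. -/
def tr (x : K) : K := x + D.σ x + D.σ (D.σ x)

lemma σ_σ_θ : D.σ (D.θ ^ 2 - 2) = 1 - D.θ - D.θ ^ 2 := by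
  have h := D.θ_rel
  simp only [map_sub, map_pow, map_ofNat, D.σ_θ]
  grind

lemma tr_eq (x : K) : ∃ a b : ℚ, D.tr x = a + b * D.j := by
  obtain ⟨a, b, c, d, e, f, rfl⟩ := D.exists_rep x
  refine ⟨3 * a - c + 5 * e, 3 * b - d + 5 * f, ?_⟩
  have h := D.θ_rel
  simp only [tr, map_add, map_mul, map_pow, map_ratCast, D.σ_j, D.σ_θ, D.σ_σ_θ]
  push_cast
  grind

lemma tr_add (x y : K) : D.tr (x + y) = D.tr x + D.tr y := by
  simp only [tr, map_add]; ring

lemma tr_smul (a b : ℚ) (x : K) : D.tr ((a + b * D.j) * x) = (a + b * D.j) * D.tr x := by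
  simp only [tr, map_add, map_mul, map_ratCast, D.σ_j]; ring

lemma τ_σ (x : K) : D.τ (D.σ x) = D.σ (D.τ x) := by
  obtain ⟨a, b, c, d, e, f, rfl⟩ := D.exists_rep x
  simp [D.τ_j, D.τ_θ, D.σ_j, D.σ_θ, map_ofNat]

lemma tr_ν_mul_τ_ν (k l : Fin 3) : D.tr (D.ν k * D.τ (D.ν l)) = if k = l then 7 else 0 := by
  have h := D.θ_rel
  have h' := D.j_rel
  fin_cases k <;> fin_cases l <;>
  simp [tr, ν, D.σ_j, D.σ_θ, D.τ_j, D.τ_θ, map_ofNat] <;>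
  grind

/-- The dual expansion of an element with respect to `ν`. -/
lemma sum_tr_mul_ν (x : K) : ∑ k, D.tr (x * D.τ (D.ν k)) * D.ν k = 7 * x := by
  have h := D.θ_rel
  have h' := D.j_rel
  have h1 : ∑ k, D.τ (D.ν k) * D.ν k = 7 := by
    simp [Fin.sum_univ_three, ν, D.τ_j, D.τ_θ, map_ofNat]
    grind
  have h2 : ∑ k, D.σ (D.τ (D.ν k)) * D.ν k = 0 := by
    simp [Fin.sum_univ_three, ν, D.σ_j, D.σ_θ, D.τ_j, D.τ_θ, map_ofNat]
    grind
  have h3 : ∑ k, D.σ (D.σ (D.τ (D.ν k))) * D.ν k = 0 := by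
    simp [Fin.sum_univ_three, ν, D.σ_j, D.σ_θ, D.τ_j, D.τ_θ, map_ofNat]
    grind
  simp only [tr, map_mul, Fin.sum_univ_three] at *
  linear_combination x * h1 + D.σ x * h2 + D.σ (D.σ x) * h3

lemma rat_eq_zero {a b : ℚ} (h : (a : K) + b * D.j = 0) : a = 0 ∧ b = 0 := by
  have h1 : ((a ^ 2 - a * b + b ^ 2 : ℚ) : K) = 0 := by
    push_cast
    linear_combination (a - b - b * D.j : K) * h + (b : K) ^ 2 * D.j_rel
  have h2 : a ^ 2 - a * b + b ^ 2 = 0 := by exact_mod_cast h1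
  have h3 : b = 0 := by nlinarith [sq_nonneg (2 * a - b), sq_nonneg b]
  subst h3
  simpa using h2

lemma coeff_eq_zero {a b : Fin 3 → ℚ} (h : ∑ k, (a k + b k * D.j) * D.ν k = 0) (l : Fin 3) :
    a l = 0 ∧ b l = 0 := by
  have h1 : D.tr ((∑ k, (a k + b k * D.j) * D.ν k) * D.τ (D.ν l)) = 7 * (a l + b l * D.j) := by
    simp only [Fin.sum_univ_three, add_mul _ _ (D.τ (D.ν l)), mul_assoc _ _ (D.τ (D.ν l)), tr_add,
      tr_smul, tr_ν_mul_τ_ν]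
    fin_cases l <;> simp <;> ring
  rw [h] at h1
  refine D.rat_eq_zero ?_
  simpa [tr] using h1.symm

lemma isIntegral_j : IsIntegral ℤ D.j :=
  ⟨Polynomial.X ^ 2 + Polynomial.X + 1, by monicity!, by simpa using D.j_rel⟩

lemma isIntegral_θ : IsIntegral ℤ D.θ :=
  ⟨Polynomial.X ^ 3 + Polynomial.X ^ 2 - 2 * Polynomial.X - 1, by monicity!, by
    simpa using D.θ_rel⟩

lemma isIntegral_map (e : K ≃ₐ[ℚ] K) {x : K} (hx : IsIntegral ℤ x) : IsIntegral ℤ (e x) :=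
  hx.map e

lemma exists_int_of_isIntegral_rat {r : ℚ} (h : IsIntegral ℤ (r : K)) :
    ∃ n : ℤ, r = n := by
  have h1 : IsIntegral ℤ r := by
    rw [← isIntegral_algebraMap_iff (A := ℚ) (B := K) (algebraMap ℚ K).injective]
    simpa using h
  obtain ⟨n, hn⟩ := IsIntegrallyClosed.isIntegral_iff.1 h1
  exact ⟨n, by simpa using hn.symm⟩

/-- The ring of integers of `ℚ(j)` is `ℤ[j]`. -/
lemma exists_int_of_isIntegral {a b : ℚ} (h : IsIntegral ℤ ((a : K) + b * D.j)) :
    ∃ m n : ℤ, a = m ∧ b = n := by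
  have hτ := isIntegral_map D.τ h
  have hj := h.mul D.isIntegral_j
  have hτj := isIntegral_map D.τ hj
  have hrel := D.j_rel
  simp only [map_add, map_mul, map_ratCast, D.τ_j] at hτ hτj
  obtain ⟨p, hp⟩ := exists_int_of_isIntegral_rat (K := K) (r := 2 * a - b) (by
    rw [show ((2 * a - b : ℚ) : K) = (a + b * D.j) + (a + b * (-1 - D.j)) by push_cast; ring]
    exact h.add hτ)
  obtain ⟨q, hq⟩ := exists_int_of_isIntegral_rat (K := K) (r := - a - b) (by
    rw [show ((- a - b : ℚ) : K) = (a + b * D.j) * D.j + (a + b * (-1 - D.j)) * (-1 - D.j) by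
      push_cast; grind]
    exact hj.add hτj)
  obtain ⟨N, hN⟩ := exists_int_of_isIntegral_rat (K := K) (r := a ^ 2 - a * b + b ^ 2) (by
    rw [show ((a ^ 2 - a * b + b ^ 2 : ℚ) : K) = (a + b * D.j) * (a + b * (-1 - D.j)) by
      push_cast; grind]
    exact h.mul hτ)
  have ha : 3 * a = (p - q : ℤ) := by push_cast; linarith
  have hb : 3 * b = (- p - 2 * q : ℤ) := by push_cast; linarith
  have hN' : p ^ 2 + p * q + q ^ 2 = 3 * N := by
    have : (p ^ 2 + p * q + q ^ 2 : ℚ) = 3 * N := by rw [← hp, ← hq, ← hN]; ring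
    exact_mod_cast this
  have h3 : (3 : ℤ) ∣ p - q := by
    refine Int.prime_three.dvd_of_dvd_pow (n := 2) ⟨N - p * q, ?_⟩
    linear_combination hN'
  obtain ⟨s, hs⟩ := h3
  refine ⟨s, - q - s, ?_, ?_⟩
  · rw [hs] at ha
    push_cast at ha
    linarith
  · rw [show - p - 2 * q = 3 * (- q - s) by linarith] at hb
    push_cast at hb ⊢
    linarith

lemma seven_dvd {a b u v : ℤ} (h1 : a ^ 3 + b ^ 3 - 3 * a * b ^ 2 = 7 * u)
    (h2 : 3 * a ^ 2 * b - 3 * a * b ^ 2 = 7 * v) : (7 : ℤ) ∣ a ∧ (7 : ℤ) ∣ b := by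
  have key : ∀ x y : ZMod 7, x ^ 3 + y ^ 3 - 3 * x * y ^ 2 = 0 →
      3 * x ^ 2 * y - 3 * x * y ^ 2 = 0 → x = 0 ∧ y = 0 := by decide
  have h7 : (7 : ZMod 7) = 0 := rfl
  have h1' := congrArg (Int.cast : ℤ → ZMod 7) h1
  have h2' := congrArg (Int.cast : ℤ → ZMod 7) h2
  push_cast at h1' h2'
  rw [h7, zero_mul] at h1' h2'
  obtain ⟨ha, hb⟩ := key a b h1' h2'
  exact ⟨(ZMod.intCast_zmod_eq_zero_iff_dvd a 7).1 ha, (ZMod.intCast_zmod_eq_zero_iff_dvd b 7).1 hb⟩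

/-- The relative trace maps the ideal generated by `α * τ α` into `7 ℤ[j]`. -/
lemma tr_mem {z : K} (hz : IsIntegral ℤ z) :
    ∃ m n : ℤ, D.tr (D.α * D.τ D.α * z) = 7 * (m + n * D.j) := by
  have hθ := D.θ_rel
  have hj := D.j_rel
  have hiθ := D.isIntegral_θ
  have h2 : IsIntegral ℤ (2 : K) := mod_cast isIntegral_natCast (R := ℤ) (B := K) 2
  have h3 : IsIntegral ℤ (3 : K) := mod_cast isIntegral_natCast (R := ℤ) (B := K) 3
  have h5 : IsIntegral ℤ (5 : K) := mod_cast isIntegral_natCast (R := ℤ) (B := K) 5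
  set w : K := z + (3 - D.θ - D.θ ^ 2) * D.σ z + (5 - D.θ - 2 * D.θ ^ 2) * D.σ (D.σ z) with hw
  have hσz := isIntegral_map D.σ hz
  have hwi : IsIntegral ℤ w :=
    (hz.add (((h3.sub hiθ).sub (hiθ.pow 2)).mul hσz)).add
      (((h5.sub hiθ).sub (h2.mul (hiθ.pow 2))).mul (isIntegral_map D.σ hσz))
  have hβ : D.α * D.τ D.α = 1 + D.θ + D.θ ^ 2 := by
    simp [α, D.τ_j, D.τ_θ]; grind
  have hσβ : D.σ (1 + D.θ + D.θ ^ 2) = (1 + D.θ + D.θ ^ 2) * (3 - D.θ - D.θ ^ 2) := by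
    simp [D.σ_θ]; grind
  have hσσβ : D.σ (D.σ (1 + D.θ + D.θ ^ 2)) = (1 + D.θ + D.θ ^ 2) * (5 - D.θ - 2 * D.θ ^ 2) := by
    simp [D.σ_θ, map_ofNat]; grind
  have hprod : (1 + D.θ + D.θ ^ 2) * D.σ (1 + D.θ + D.θ ^ 2) *
      D.σ (D.σ (1 + D.θ + D.θ ^ 2)) = 7 := by
    rw [hσσβ, hσβ]; grind
  obtain ⟨a, b, hab⟩ := D.tr_eq (D.α * D.τ D.α * z)
  have htw : (a + b * D.j : K) = (1 + D.θ + D.θ ^ 2) * w := by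
    rw [← hab, hβ, tr]
    simp only [map_mul, hσσβ]
    rw [hσβ, hw]
    ring
  have hti : IsIntegral ℤ (a + b * D.j : K) := by
    rw [htw]
    exact ((isIntegral_one.add hiθ).add (hiθ.pow 2)).mul hwi
  obtain ⟨m, n, rfl, rfl⟩ := D.exists_int_of_isIntegral hti
  have hσt : D.σ ((m : ℚ) + (n : ℚ) * D.j : K) = (m : ℚ) + (n : ℚ) * D.j := by
    simp [D.σ_j]
  have hcube : ((m : ℚ) + (n : ℚ) * D.j : K) ^ 3 = 7 * (w * D.σ w * D.σ (D.σ w)) := by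
    calc ((m : ℚ) + (n : ℚ) * D.j : K) ^ 3
        = ((m : ℚ) + (n : ℚ) * D.j : K) * D.σ ((m : ℚ) + (n : ℚ) * D.j : K) *
          D.σ (D.σ ((m : ℚ) + (n : ℚ) * D.j : K)) := by rw [hσt, hσt]; ring
      _ = 7 * (w * D.σ w * D.σ (D.σ w)) := by
        rw [htw, ← hprod]
        simp only [map_mul]
        ring
  have hσw := isIntegral_map D.σ hwi
  have hint := (hwi.mul hσw).mul (isIntegral_map D.σ hσw)
  have hquot : (((m ^ 3 + n ^ 3 - 3 * m * n ^ 2) / 7 : ℚ) : K) +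
      ((3 * m ^ 2 * n - 3 * m * n ^ 2) / 7 : ℚ) * D.j = w * D.σ w * D.σ (D.σ w) := by
    refine mul_left_cancel₀ (show (7 : K) ≠ 0 by norm_num) ?_
    rw [← hcube]
    push_cast
    linear_combination (-3 * m * n ^ 2 + n ^ 3 * (1 - D.j) : K) * hj
  rw [← hquot] at hint
  obtain ⟨u, v, hu, hv⟩ := D.exists_int_of_isIntegral hint
  obtain ⟨⟨p, rfl⟩, ⟨q, rfl⟩⟩ := seven_dvd (a := m) (b := n) (u := u) (v := v)
    (by
      have : (m ^ 3 + n ^ 3 - 3 * m * n ^ 2 : ℚ) = 7 * u := by rw [← hu]; ring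
      exact_mod_cast this)
    (by
      have : (3 * m ^ 2 * n - 3 * m * n ^ 2 : ℚ) = 7 * v := by rw [← hv]; ring
      exact_mod_cast this)
  refine ⟨p, q, ?_⟩
  rw [hab]
  push_cast
  ring

/-- The elements `ν k` span the ideal generated by `α` over `ℤ[j]`. -/
lemma exists_isIntegral_iff (x : K) :
    (∃ y, IsIntegral ℤ y ∧ x = D.α * y) ↔
      ∃ c : Fin 3 → ℤ × ℤ, x = ∑ k, (((c k).1 : K) + ((c k).2 : K) * D.j) * D.ν k := by
  have hθ := D.θ_rel
  have hj := D.j_rel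
  have hiθ := D.isIntegral_θ
  have hij := D.isIntegral_j
  set μ : Fin 3 → K := ![1, D.θ ^ 2 - 2, D.θ ^ 2 + D.θ - 2] with hμ
  have hμi (k : Fin 3) : IsIntegral ℤ (μ k) := by
    have h2 : IsIntegral ℤ (2 : K) := mod_cast isIntegral_natCast (R := ℤ) (B := K) 2
    fin_cases k
    · exact isIntegral_one
    · exact (hiθ.pow 2).sub h2
    · exact ((hiθ.pow 2).add hiθ).sub h2
  have hνμ (k : Fin 3) : D.ν k = D.α * μ k := by
    fin_cases k <;> simp [ν, α, hμ] <;> grind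
  constructor
  · rintro ⟨y, hy, rfl⟩
    have key (k : Fin 3) : ∃ m n : ℤ,
        D.tr (D.α * y * D.τ (D.ν k)) = 7 * (m + n * D.j) := by
      obtain ⟨m, n, h⟩ := D.tr_mem (hy.mul (isIntegral_map D.τ (hμi k)))
      refine ⟨m, n, ?_⟩
      rw [← h, hνμ, map_mul]
      congr 1
      ring
    choose m n hmn using key
    refine ⟨fun k ↦ (m k, n k), ?_⟩
    have h := D.sum_tr_mul_ν (D.α * y)
    simp_rw [hmn, mul_assoc (7 : K), ← Finset.mul_sum] at h
    exact (mul_left_cancel₀ (by norm_num) h).symm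
  · rintro ⟨c, rfl⟩
    refine ⟨∑ k, (((c k).1 : K) + ((c k).2 : K) * D.j) * μ k, ?_, ?_⟩
    · exact IsIntegral.sum _ fun k _ ↦
        ((isIntegral_intCast _).add ((isIntegral_intCast _).mul hij)).mul (hμi k)
    · rw [Finset.mul_sum]
      refine Finset.sum_congr rfl fun k _ ↦ ?_
      rw [hνμ]
      ring

lemma finrank_eq (D : EisensteinCubic K) : Module.finrank ℚ K = 6 := by
  set v : Fin 3 × Fin 2 → K := fun p ↦ D.j ^ (p.2 : ℕ) * D.ν p.1 with hv
  have hsum (g : Fin 3 × Fin 2 → ℚ) :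
      ∑ p, g p • v p = ∑ k, ((g (k, 0) : K) + (g (k, 1) : K) * D.j) * D.ν k := by
    rw [Fintype.sum_prod_type]
    refine Finset.sum_congr rfl fun k _ ↦ ?_
    simp [hv, Fin.sum_univ_two, Rat.smul_def]
    ring
  have hli : LinearIndependent ℚ v := by
    rw [Fintype.linearIndependent_iff]
    intro g hg
    rw [hsum] at hg
    rintro ⟨k, i⟩
    obtain ⟨h0, h1⟩ := D.coeff_eq_zero hg k
    fin_cases i
    exacts [h0, h1]
  have hsp : ⊤ ≤ Submodule.span ℚ (Set.range v) := by
    intro x _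
    rw [Submodule.mem_span_range_iff_exists_fun]
    choose a b hab using fun k ↦ D.tr_eq (x * D.τ (D.ν k))
    refine ⟨fun p ↦ if p.2 = 0 then a p.1 / 7 else b p.1 / 7, ?_⟩
    rw [hsum]
    have h := D.sum_tr_mul_ν x
    simp only [hab, Fin.sum_univ_three] at h
    simp [Fin.sum_univ_three]
    linear_combination h / 7
  rw [Module.finrank_eq_card_basis (Module.Basis.mk hli hsp)]
  rfl

lemma norm_α_pow : Algebra.norm ℚ D.α ^ 6 = 7 ^ 6 := by
  have hθ := D.θ_rel
  have hj := D.j_rel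
  have h : (D.α * D.σ D.α * D.σ (D.σ D.α)) * (D.τ D.α * D.σ (D.τ D.α) * D.σ (D.σ (D.τ D.α))) =
      algebraMap ℚ K 7 := by
    simp [α, D.τ_j, D.τ_θ, D.σ_j, D.σ_θ, map_ofNat]
    grind
  have h' := congrArg (Algebra.norm ℚ) h
  rw [Algebra.norm_algebraMap, D.finrank_eq] at h'
  simp only [map_mul, Algebra.norm_eq_of_algEquiv] at h'
  rw [← h']
  ring

end EisensteinCubic

lemma cubic_relation_of_isPrimitiveRoot_seven {ζ : ℂ} (h : IsPrimitiveRoot ζ 7) :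
    (ζ + ζ⁻¹) ^ 3 + (ζ + ζ⁻¹) ^ 2 - 2 * (ζ + ζ⁻¹) - 1 = 0 := by
  have h0 : ζ ≠ 0 := h.ne_zero (by norm_num)
  have hs := h.geom_sum_eq_zero (by norm_num)
  simp only [Finset.sum_range_succ, Finset.sum_range_zero] at hs
  field_simp
  linear_combination hs

/-- The elements of the field generated by two algebraic numbers `j`, `θ` of degrees two and three
have the expected form. -/
lemma exists_rep_of_mem_adjoin {j θ : ℂ} (hj : j ^ 2 + j + 1 = 0)
    (hθ : θ ^ 3 + θ ^ 2 - 2 * θ - 1 = 0) {x : ℂ} (hx : x ∈ IntermediateField.adjoin ℚ {j, θ}) :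
    ∃ a b c d e f : ℚ, x = (a + b * j) + (c + d * j) * θ + (e + f * j) * θ ^ 2 := by
  have hij : IsIntegral ℚ j :=
    ⟨Polynomial.X ^ 2 + Polynomial.X + 1, by monicity!, by simpa using hj⟩
  have hiθ : IsIntegral ℚ θ :=
    ⟨Polynomial.X ^ 3 + Polynomial.X ^ 2 - 2 * Polynomial.X - 1, by monicity!, by simpa using hθ⟩
  have halg : ∀ y ∈ ({j, θ} : Set ℂ), IsAlgebraic ℚ y := by
    rintro y (rfl | rfl)
    exacts [hij.isAlgebraic, hiθ.isAlgebraic]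
  rw [← IntermediateField.mem_toSubalgebra,
    IntermediateField.adjoin_toSubalgebra_of_isAlgebraic halg] at hx
  induction hx using Algebra.adjoin_induction with
  | mem y hy =>
    rcases hy with rfl | rfl
    · exact ⟨0, 1, 0, 0, 0, 0, by simp⟩
    · exact ⟨0, 0, 1, 0, 0, 0, by simp⟩
  | algebraMap r => exact ⟨r, 0, 0, 0, 0, 0, by simp⟩
  | add y z _ _ hy hz =>
    obtain ⟨a, b, c, d, e, f, rfl⟩ := hy
    obtain ⟨a', b', c', d', e', f', rfl⟩ := hz
    refine ⟨a + a', b + b', c + c', d + d', e + e', f + f', ?_⟩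
    push_cast
    ring
  | mul y z _ _ hy hz =>
    have hmul_j (a b c d e f : ℚ) : ∃ a' b' c' d' e' f' : ℚ,
        j * ((a + b * j) + (c + d * j) * θ + (e + f * j) * θ ^ 2) =
          (a' + b' * j) + (c' + d' * j) * θ + (e' + f' * j) * θ ^ 2 := by
      refine ⟨-b, a - b, -d, c - d, -f, e - f, ?_⟩
      push_cast
      linear_combination (b + d * θ + f * θ ^ 2) * hj
    have hmul_θ (a b c d e f : ℚ) : ∃ a' b' c' d' e' f' : ℚ,
        θ * ((a + b * j) + (c + d * j) * θ + (e + f * j) * θ ^ 2) =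
          (a' + b' * j) + (c' + d' * j) * θ + (e' + f' * j) * θ ^ 2 := by
      refine ⟨e, f, a + 2 * e, b + 2 * f, c - e, d - f, ?_⟩
      push_cast
      linear_combination (e + f * j) * hθ
    obtain ⟨a, b, c, d, e, f, rfl⟩ := hy
    obtain ⟨a₀, b₀, c₀, d₀, e₀, f₀, rfl⟩ := hz
    obtain ⟨a₁, b₁, c₁, d₁, e₁, f₁, h₁⟩ := hmul_j a₀ b₀ c₀ d₀ e₀ f₀
    obtain ⟨a₂, b₂, c₂, d₂, e₂, f₂, h₂⟩ := hmul_θ a₀ b₀ c₀ d₀ e₀ f₀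
    obtain ⟨a₃, b₃, c₃, d₃, e₃, f₃, h₃⟩ := hmul_j a₂ b₂ c₂ d₂ e₂ f₂
    obtain ⟨a₄, b₄, c₄, d₄, e₄, f₄, h₄⟩ := hmul_θ a₂ b₂ c₂ d₂ e₂ f₂
    obtain ⟨a₅, b₅, c₅, d₅, e₅, f₅, h₅⟩ := hmul_j a₄ b₄ c₄ d₄ e₄ f₄
    rw [← h₂] at h₃ h₄
    rw [← h₄] at h₅
    refine ⟨a * a₀ + b * a₁ + c * a₂ + d * a₃ + e * a₄ + f * a₅,
      a * b₀ + b * b₁ + c * b₂ + d * b₃ + e * b₄ + f * b₅,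
      a * c₀ + b * c₁ + c * c₂ + d * c₃ + e * c₄ + f * c₅,
      a * d₀ + b * d₁ + c * d₂ + d * d₃ + e * d₄ + f * d₅,
      a * e₀ + b * e₁ + c * e₂ + d * e₃ + e * e₄ + f * e₅,
      a * f₀ + b * f₁ + c * f₂ + d * f₃ + e * f₄ + f * f₅, ?_⟩
    push_cast
    linear_combination (b : ℂ) * h₁ + (c : ℂ) * h₂ + (d : ℂ) * h₃ + (e : ℂ) * h₄ + (f : ℂ) * h₅

/-- Complex conjugation on a field generated by `j` and `θ` with `j` mapping to `-1 - j` and `θ`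
real. -/
lemma exists_conj_algEquiv {j θ : ℂ} (hj : star j = -1 - j) (hθ : star θ = θ)
    {K : IntermediateField ℚ ℂ} (hK : K = IntermediateField.adjoin ℚ {j, θ}) :
    ∃ τ : K ≃ₐ[ℚ] K, ∀ x : K, ((τ x : K) : ℂ) = star (x : ℂ) := by
  set c : ℂ ≃ₐ[ℚ] ℂ := Complex.conjAe.restrictScalars ℚ with hc
  have hcx (x : ℂ) : c x = star x := rfl
  have hjK : j ∈ K := hK ▸ IntermediateField.subset_adjoin ℚ _ (by simp)
  have hθK : θ ∈ K := hK ▸ IntermediateField.subset_adjoin ℚ _ (by simp)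
  have hle : K.map c.toAlgHom ≤ K := by
    nth_rewrite 1 [hK]
    rw [IntermediateField.adjoin_map, IntermediateField.adjoin_le_iff]
    rintro _ ⟨y, rfl | rfl, rfl⟩
    · change star y ∈ K
      rw [hj]
      exact sub_mem (neg_mem (one_mem K)) hjK
    · change star y ∈ K
      rwa [hθ]
  have hmap : K.map c.toAlgHom = K := by
    refine le_antisymm hle fun x hx ↦ ?_
    refine ⟨star x, hle ⟨x, hx, rfl⟩, ?_⟩
    change star (star x) = x
    exact star_star x
  exact ⟨(IntermediateField.intermediateFieldMap c K).trans (IntermediateField.equivOfEq hmap),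
    fun _ ↦ rfl⟩


open IntermediateField NumberField in
theorem stmt_16 (ζ j : ℂ)
    (hζ : ζ = Complex.exp (2 * (Real.pi : ℂ) * Complex.I / 7))
    (hj : j = Complex.exp (2 * (Real.pi : ℂ) * Complex.I / 3))
    (θ : ℂ) (hθ : θ = ζ + ζ⁻¹)
    (K : IntermediateField ℚ ℂ) (hK : K = ℚ⟮j, θ⟯) [NumberField K]
    (σ : K ≃ₐ[ℚ] K)
    (hσj : ∀ z : K, (z : ℂ) = j → ((σ z : K) : ℂ) = j)
    (hσθ : ∀ z : K, (z : ℂ) = θ → ((σ z : K) : ℂ) = ζ ^ 2 + (ζ ^ 2)⁻¹)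
    (ν : Fin 3 → K)
    (hν0 : ((ν 0 : K) : ℂ) = (1 + j) + θ)
    (hν1 : ((ν 1 : K) : ℂ) = (-1 - 2 * j) + j * θ ^ 2)
    (hν2 : ((ν 2 : K) : ℂ) = (-1 - 2 * j) + (1 + j) * θ + (1 + j) * θ ^ 2)
    (α : 𝓞 K) (hα : ((α : K) : ℂ) = (1 + j) + θ) :
    Ideal.absNorm (Ideal.span {α}) = 7 ∧
    (∀ k l : Fin 3,
      (∑ m ∈ Finset.range 3, (((σ ^ m) (ν k) : K) : ℂ) * star (((σ ^ m) (ν l) : K) : ℂ))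
        = if k = l then 7 else 0) ∧
    (∀ x : 𝓞 K, x ∈ Ideal.span {α} ↔
      ∃ c : Fin 3 → ℤ × ℤ,
        ((x : K) : ℂ) =
          ∑ k : Fin 3, (((c k).1 : ℂ) + ((c k).2 : ℂ) * j) * ((ν k : K) : ℂ)) ∧
    (∀ c : Fin 3 → ℤ × ℤ,
      (∑ k : Fin 3, (((c k).1 : ℂ) + ((c k).2 : ℂ) * j) * ((ν k : K) : ℂ)) = 0 →
      ∀ k, c k = 0) := by
  have hζp : IsPrimitiveRoot ζ 7 := by
    rw [hζ]; exact_mod_cast Complex.isPrimitiveRoot_exp 7 (by norm_num)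
  have hjp : IsPrimitiveRoot j 3 := by
    rw [hj]; exact_mod_cast Complex.isPrimitiveRoot_exp 3 (by norm_num)
  have hθrel : θ ^ 3 + θ ^ 2 - 2 * θ - 1 = 0 := hθ ▸ cubic_relation_of_isPrimitiveRoot_seven hζp
  have hjrel : j ^ 2 + j + 1 = 0 := by
    have h := hjp.geom_sum_eq_zero (by norm_num)
    simp only [Finset.sum_range_succ, Finset.sum_range_zero] at h
    linear_combination h
  have hstar {z : ℂ} {n : ℕ} (hn : n ≠ 0) (hz : IsPrimitiveRoot z n) : star z = z⁻¹ :=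
    (Complex.inv_eq_conj (hz.norm'_eq_one hn)).symm
  have hjstar : star j = -1 - j := by
    rw [hstar (by norm_num) hjp]
    refine inv_eq_of_mul_eq_one_right ?_
    linear_combination -hjrel
  have hθstar : star θ = θ := by
    rw [hθ, star_add, star_inv₀, hstar (by norm_num) hζp, inv_inv, add_comm]
  obtain ⟨τ, hτ⟩ := exists_conj_algEquiv hjstar hθstar hK
  have hjK : j ∈ K := hK ▸ subset_adjoin ℚ _ (by simp)
  have hθK : θ ∈ K := hK ▸ subset_adjoin ℚ _ (by simp)
  have hζ0 : ζ ≠ 0 := hζp.ne_zero (by norm_num)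
  have h2 : ((2 : K) : ℂ) = 2 := rfl
  let D : EisensteinCubic K :=
    { j := ⟨j, hjK⟩
      θ := ⟨θ, hθK⟩
      σ := σ
      τ := τ
      j_rel := Subtype.ext (by simpa using hjrel)
      θ_rel := Subtype.ext (by simpa [h2] using hθrel)
      σ_j := Subtype.ext (hσj _ rfl)
      σ_θ := Subtype.ext (by
        rw [hσθ _ rfl]
        change _ = θ ^ 2 - 2
        rw [hθ]
        field_simp
        ring)
      τ_j := Subtype.ext (by simpa using (hτ _).trans hjstar)
      τ_θ := Subtype.ext ((hτ _).trans hθstar)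
      exists_rep := fun x ↦ by
        obtain ⟨a, b, c, d, e, f, h⟩ := exists_rep_of_mem_adjoin hjrel hθrel (x := x)
          (by rw [← hK]; exact x.2)
        exact ⟨a, b, c, d, e, f, Subtype.ext (by simpa using h)⟩ }
  have hDν : ν = D.ν := by
    ext k
    fin_cases k
    · simpa [EisensteinCubic.ν, D, h2] using hν0
    · simpa [EisensteinCubic.ν, D, h2] using hν1
    · simpa [EisensteinCubic.ν, D, h2] using hν2
  have hDα : (α : K) = D.α := Subtype.ext (by simpa [EisensteinCubic.α] using hα)
  have hcoe (c : Fin 3 → ℤ × ℤ) :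
      ∑ k : Fin 3, (((c k).1 : ℂ) + ((c k).2 : ℂ) * j) * ((ν k : K) : ℂ) =
        ((∑ k, (((c k).1 : K) + ((c k).2 : K) * D.j) * D.ν k : K) : ℂ) := by
    simp [hDν, Fin.sum_univ_three, D]
  refine ⟨?_, ?_, ?_, ?_⟩
  · rw [Ideal.absNorm_span_singleton]
    have h := D.norm_α_pow
    rw [← hDα, ← Algebra.coe_norm_int] at h
    have h' : Algebra.norm ℤ α ^ 6 = 7 ^ 6 := by exact_mod_cast h
    have h'' := congrArg Int.natAbs h'
    rw [Int.natAbs_pow, Int.natAbs_pow] at h''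
    exact Nat.pow_left_injective (n := 6) (by norm_num) h''
  · intro k l
    have h := congrArg (Subtype.val : K → ℂ) (D.tr_ν_mul_τ_ν k l)
    have hστ (x : K) : ((σ (τ x) : K) : ℂ) = star ((σ x : K) : ℂ) := by
      rw [← hτ]; exact congrArg _ (D.τ_σ x).symm
    have hσστ (x : K) : ((σ (σ (τ x)) : K) : ℂ) = star ((σ (σ x) : K) : ℂ) := by
      rw [← hστ]; exact congrArg (fun y ↦ ((σ y : K) : ℂ)) (D.τ_σ x).symm
    simp only [EisensteinCubic.tr, map_mul, IntermediateField.coe_add, IntermediateField.coe_mul,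
      D, hτ, hστ, hσστ] at h
    simp only [Finset.sum_range_succ, Finset.sum_range_zero, hDν, pow_succ, pow_zero, one_mul,
      AlgEquiv.mul_apply, AlgEquiv.one_apply, zero_add]
    rw [h]
    split_ifs <;> rfl
  · intro x
    simp only [hcoe, SetLike.coe_eq_coe]
    rw [← D.exists_isIntegral_iff, Ideal.mem_span_singleton, ← hDα]
    constructor
    · rintro ⟨y, rfl⟩
      exact ⟨y, RingOfIntegers.isIntegral_coe y, by simp⟩
    · rintro ⟨y, hy, h⟩
      exact ⟨⟨y, hy⟩, RingOfIntegers.ext h⟩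
  · intro c hc k
    rw [hcoe] at hc
    have h : ∑ k, ((((c k).1 : ℚ) : K) + (((c k).2 : ℚ) : K) * D.j) * D.ν k = 0 :=
      Subtype.ext (by simpa using hc)
    obtain ⟨h1, h2⟩ := D.coeff_eq_zero (a := fun k ↦ (c k).1) (b := fun k ↦ (c k).2) h k
    exact Prod.ext (by exact_mod_cast h1) (by exact_mod_cast h2)
end
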